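/- arXiv:2211.14251 — 2 statements merged into one kernel-verified Lean document; each statement's English description precedes it below -/
import Mathlib

section
/- Let K ⊆ ℝ² be a compact set and x, y ∈ K lie in different connected components of K. Then there exists a Jordan curve (a subset of ℝ² homeomorphic to the circle) disjoint from K that separates x from y, i.e., x and y lie in different connected components of the complement of the curve. -/
/-- A Jordan curve in the plane: a set homeomorphic to the unit circle. -/
def IsJordanCurve (Γ : Set (EuclideanSpace ℝ (Fin 2))) : Prop :=
  Nonempty (Γ ≃ₜ Metric.sphere (0 : EuclideanSpace ℝ (Fin 2)) 1)

namespace JC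

/-- The six directions of the triangular lattice. -/
def D : Fin 6 → ℤ × ℤ := ![(1,0),(0,1),(-1,1),(-1,0),(0,-1),(1,-1)]

lemma D_rev (d : Fin 6) : D d + D (d+3) = 0 := by revert d; decide
lemma D_tri (d : Fin 6) : D d + D (d+2) = D (d+1) := by revert d; decide
lemma D_tri' (d : Fin 6) : D (d+1) + D (d+5) = D d := by revert d; decide
lemma D_tri4 (d : Fin 6) : D (d+1) + D (d+4) = 0 := by revert d; decide
lemma D_25 (d : Fin 6) : D (d+5) + D (d+2) = 0 := by revert d; decide
lemma D_51 (d : Fin 6) : D (d+5) + D (d+1) = D d := by revert d; decide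

abbrev Ed := (ℤ × ℤ) × Fin 6

def E (f : ℤ × ℤ → Bool) : Set Ed := {e | f e.1 = true ∧ f (e.1 + D e.2) = false}

def B (f : ℤ × ℤ → Bool) : Set Ed := {e | f e.1 ≠ f (e.1 + D e.2)}

def rev (e : Ed) : Ed := (e.1 + D e.2, e.2 + 3)

def nxt (f : ℤ × ℤ → Bool) (e : Ed) : Ed :=
  if f (e.1 + D (e.2+1)) = true then (e.1 + D (e.2+1), e.2+5) else (e.1, e.2+1)

def prv (f : ℤ × ℤ → Bool) (e : Ed) : Ed :=
  if f (e.1 + D (e.2+5)) = true then (e.1 + D (e.2+5), e.2+1) else (e.1, e.2+5)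

lemma rev_rev (e : Ed) : rev (rev e) = e := by
  rcases e with ⟨u, d⟩
  have h6 := (by decide : ∀ d : Fin 6, d + 3 + 3 = d) d
  simp only [rev, add_assoc u, D_rev, add_zero, h6]

lemma nxt_mem {f e} (h : e ∈ E f) : nxt f e ∈ E f := by
  rcases e with ⟨u, d⟩
  simp only [E, Set.mem_ofPred_eq, nxt] at *
  split_ifs with h1
  · refine ⟨h1, ?_⟩
    simp only [add_assoc, D_tri']; exact h.2
  · exact ⟨h.1, by simpa using h1⟩

lemma prv_mem {f e} (h : e ∈ E f) : prv f e ∈ E f := by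
  rcases e with ⟨u, d⟩
  simp only [E, Set.mem_ofPred_eq, prv] at *
  split_ifs with h1
  · refine ⟨h1, ?_⟩
    simp only [add_assoc, D_51]; exact h.2
  · exact ⟨h.1, by simpa using h1⟩

lemma nxt_prv {f e} (h : e ∈ E f) : nxt f (prv f e) = e := by
  rcases e with ⟨u, d⟩
  simp only [E, Set.mem_ofPred_eq, prv] at *
  have h6 := (by decide : ∀ d : Fin 6, d + 1 + 5 = d) d
  have h6' := (by decide : ∀ d : Fin 6, d + 5 + 1 = d) d
  have h2 := (by decide : ∀ d : Fin 6, d + 1 + 1 = d + 2) d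
  split_ifs with h1
  · simp only [nxt, add_assoc u, h2, D_25, add_zero, h.1, if_true, h6]
  · simp only [nxt, h6', h.2]; simp

lemma prv_nxt {f e} (h : e ∈ E f) : prv f (nxt f e) = e := by
  rcases e with ⟨u, d⟩
  simp only [E, Set.mem_ofPred_eq, nxt] at *
  have h6 := (by decide : ∀ d : Fin 6, d + 1 + 5 = d) d
  have h6' := (by decide : ∀ d : Fin 6, d + 5 + 1 = d) d
  have h2 := (by decide : ∀ d : Fin 6, d + 5 + 5 = d + 4) d
  split_ifs with h1
  · simp only [prv, add_assoc u, h2, D_tri4, add_zero, h.1, if_true, h6']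
  · simp only [prv, h6, h.2]; simp

def σ (f : ℤ × ℤ → Bool) : Equiv.Perm (E f) where
  toFun e := ⟨nxt f e, nxt_mem e.2⟩
  invFun e := ⟨prv f e, prv_mem e.2⟩
  left_inv e := by ext1; exact prv_nxt e.2
  right_inv e := by ext1; exact nxt_prv e.2

/-- third vertex cocycle -/
lemma cocycle {f : ℤ × ℤ → Bool} {C : Set Ed} (hC : C ⊆ E f)
    (hinv : ∀ e ∈ E f, e ∈ C ↔ nxt f e ∈ C) (u : ℤ × ℤ) (d : Fin 6) :
    ((u,d) ∈ C ∨ rev (u,d) ∈ C) ↔ (((u + D d, d+2) ∈ C ∨ rev (u+D d, d+2) ∈ C) ↔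
      ¬ ((u, d+1) ∈ C ∨ rev (u,d+1) ∈ C)) := by
  have e23 := (by decide : ∀ d : Fin 6, d + 2 + 3 = d + 5) d
  have e13 := (by decide : ∀ d : Fin 6, d + 1 + 3 = d + 4) d
  have e21 := (by decide : ∀ d : Fin 6, d + 2 + 1 = d + 3) d
  have e25 := (by decide : ∀ d : Fin 6, d + 2 + 5 = d + 1) d
  have e41 := (by decide : ∀ d : Fin 6, d + 4 + 1 = d + 5) d
  have e45 := (by decide : ∀ d : Fin 6, d + 4 + 5 = d + 3) d
  have a1 := fun h => hinv (u,d) h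
  have a2 := fun h => hinv (u + D d,d+2) h
  have a3 := fun h => hinv (u + D (d+1),d+4) h
  have d54 : D (d+1) + D (d+5) = D d := D_tri' d
  have c1 : (u,d) ∈ C → _ := fun h => hC h
  have c2 : (u+D d,d+3) ∈ C → _ := fun h => hC h
  have c3 : (u+D d,d+2) ∈ C → _ := fun h => hC h
  have c4 : (u+D (d+1),d+5) ∈ C → _ := fun h => hC h
  have c5 : (u,d+1) ∈ C → _ := fun h => hC h
  have c6 : (u+D (d+1),d+4) ∈ C → _ := fun h => hC h
  simp only [rev, nxt, E, Set.mem_ofPred_eq, add_assoc u, D_tri, D_rev, D_tri', D_tri4, e23, e13, e21, e25, e41, e45, add_zero] at *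
  generalize f u = fu at *
  generalize f (u + D d) = fv at *
  generalize f (u + D (d+1)) = fw at *
  cases fu <;> cases fv <;> cases fw <;> simp at * <;> tauto

lemma integ1 (a : ℤ → Bool) : ∃ A : ℤ → Bool, ∀ k, A (k+1) = xor (A k) (a k) := by
  let P : ℕ → Bool := fun n => Nat.rec false (fun n r => xor r (a n)) n
  let N : ℕ → Bool := fun n => Nat.rec false (fun n r => xor r (a (-(n:ℤ)-1))) n
  refine ⟨fun k => if 0 ≤ k then P k.toNat else N (-k).toNat, fun k => ?_⟩
  rcases le_or_gt 0 k with h | h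
  · lift k to ℕ using h
    have : ((k:ℤ)+1).toNat = k+1 := by omega
    have h0 : (0:ℤ) ≤ k + 1 := by omega
    simp [h0, this, P]
  · obtain ⟨n, rfl⟩ : ∃ n : ℕ, k = -(n:ℤ)-1 := ⟨(-k-1).toNat, by omega⟩
    have h1 : (-(-(n:ℤ)-1)).toNat = n+1 := by omega
    have h2 : ¬ (0:ℤ) ≤ -(n:ℤ)-1 := by omega
    have h3 : N (n+1) = xor (N n) (a (-(n:ℤ)-1)) := rfl
    simp only [h1, h2, h3, if_false]
    rcases n.eq_zero_or_pos with rfl | hn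
    · simp [P, N]
    · have h4 : ¬ (0:ℤ) ≤ -(n:ℤ)-1+1 := by omega
      have h5 : (-(-(n:ℤ)-1+1)).toNat = n := by omega
      simp only [h4, h5, if_false]
      cases N n <;> cases a (-(n:ℤ)-1) <;> rfl

lemma integ2 (X Y : ℤ → ℤ → Bool)
    (h : ∀ m n, xor (X m n) (Y (m+1) n) = xor (Y m n) (X m (n+1))) :
    ∃ c : ℤ → ℤ → Bool, (∀ m n, c (m+1) n = xor (c m n) (X m n)) ∧
      ∀ m n, c m (n+1) = xor (c m n) (Y m n) := by
  obtain ⟨H, hH⟩ := integ1 (fun m => X m 0)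
  choose V hV using fun m => integ1 (Y m)
  let c : ℤ → ℤ → Bool := fun m n => xor (H m) (xor (V m 0) (V m n))
  have hY : ∀ m n, c m (n+1) = xor (c m n) (Y m n) := by
    intro m n; simp only [c, hV]; simp
  refine ⟨c, fun m n => ?_, hY⟩
  induction n using Int.induction_on with
  | zero => simp [c, hH]
  | succ n ih =>
    have := h m n
    rw [hY, hY, ih]
    revert this
    cases X m n <;> cases Y (m+1) n <;> cases Y m n <;> cases X m (n+1) <;> simp
  | pred n ih =>
    have := h m (-(n:ℤ)-1)
    have e1 := hY m (-(n:ℤ)-1)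
    have e2 := hY (m+1) (-(n:ℤ)-1)
    rw [sub_add_cancel] at *
    rw [e1, e2] at ih
    revert this ih
    generalize X m _ = x1
    generalize X m _ = x2
    generalize Y m _ = y1
    generalize Y (m+1) _ = y2
    generalize c m _ = c1
    generalize c (m+1) _ = c2
    revert x1 x2 y1 y2 c1 c2
    decide

lemma integrate {f : ℤ × ℤ → Bool} {C : Set Ed} (hC : C ⊆ E f)
    (hinv : ∀ e ∈ E f, e ∈ C ↔ nxt f e ∈ C) :
    ∃ c : ℤ × ℤ → Bool, B c = {e | e ∈ C ∨ rev e ∈ C} := by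
  classical
  let χ : Ed → Bool := fun e => decide (e ∈ C ∨ rev e ∈ C)
  have hrev : ∀ e, χ (rev e) = χ e := by
    intro e; simp only [χ, rev_rev]; congr 1; exact propext or_comm
  have htri : ∀ u d, χ (u,d) = xor (χ (u + D d, d+2)) (χ (u,d+1)) := by
    intro u d
    have := cocycle hC hinv u d
    by_cases h1 : ((u,d) ∈ C ∨ rev (u,d) ∈ C) <;>
    by_cases h2 : ((u + D d, d+2) ∈ C ∨ rev (u+D d, d+2) ∈ C) <;>
    by_cases h3 : ((u, d+1) ∈ C ∨ rev (u,d+1) ∈ C) <;>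
    simp only [χ, h1, h2, h3] at this ⊢ <;> simp at this ⊢
  have t0 : ∀ m n, χ ((m,n),0) = xor (χ ((m+1,n),2)) (χ ((m,n),1)) := by
    intro m n; simpa [D] using htri (m,n) 0
  have t1 : ∀ m n, χ ((m+1,n),1) = xor (χ ((m,n+1),0)) (χ ((m+1,n),2)) := by
    intro m n
    have := htri (m+1,n) 1
    have h2 := hrev ((m,n+1),0)
    simp [D, rev] at this h2
    rw [this, h2]
  obtain ⟨c, hX, hY⟩ := integ2 (fun m n => χ ((m,n),0)) (fun m n => χ ((m,n),1)) (by
    intro m n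
    simp only [t0 m n, t1 m n]
    cases χ ((m+1,n),2) <;> cases χ ((m,n),1) <;> cases χ ((m,n+1),0) <;> rfl)
  refine ⟨fun u => c u.1 u.2, ?_⟩
  have key : ∀ e : Ed, xor (c e.1.1 e.1.2) (c (e.1 + D e.2).1 (e.1 + D e.2).2) = χ e := by
    have g0 : ∀ m n, xor (c m n) (c (m+1) n) = χ ((m,n),0) := by
      intro m n; rw [hX]; simp
    have g1 : ∀ m n, xor (c m n) (c m (n+1)) = χ ((m,n),1) := by
      intro m n; rw [hY]; simp
    have g2 : ∀ m n, xor (c m n) (c (m-1) (n+1)) = χ ((m,n),2) := by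
      intro m n
      have h1 := t0 (m-1) n
      have h2 := g0 (m-1) n
      have h3 := g1 (m-1) n
      rw [sub_add_cancel] at h1 h2
      rw [← h2, ← h3] at h1
      revert h1
      cases c (m-1) n <;> cases c m n <;> cases c (m-1) (n+1) <;> simp
    rintro ⟨⟨m, n⟩, d⟩
    fin_cases d
    · simpa [D] using g0 m n
    · simpa [D] using g1 m n
    · simpa [D, sub_eq_add_neg] using g2 m n
    · have h := g0 (m-1) n
      have h2 := hrev ((m-1,n),0)
      simp [rev, D] at h2
      rw [sub_add_cancel] at h
      rw [← h2] at h
      simpa [D, sub_eq_add_neg, Bool.xor_comm] using h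
    · have h := g1 m (n-1)
      have h2 := hrev ((m,n-1),1)
      simp [rev, D] at h2
      rw [sub_add_cancel] at h
      rw [← h2] at h
      simpa [D, sub_eq_add_neg, Bool.xor_comm] using h
    · have h := g2 (m+1) (n-1)
      have h2 := hrev ((m+1,n-1),2)
      simp [rev, D] at h2
      rw [sub_add_cancel, add_sub_cancel_right] at h
      rw [← h2] at h
      simpa [D, sub_eq_add_neg, Bool.xor_comm] using h
  ext e
  have := key e
  simp only [B, Set.mem_ofPred_eq]
  rw [← decide_eq_true_iff (p := (e ∈ C ∨ rev e ∈ C))]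
  change _ ↔ χ e = true
  rw [← this]
  cases c e.1.1 e.1.2 <;> cases c (e.1 + D e.2).1 (e.1 + D e.2).2 <;> simp

/-- Minimal colouring: the boundary is a single cycle. -/
lemma exists_min (f₀ : ℤ × ℤ → Bool) (hfin : (B f₀).Finite) (p q : ℤ × ℤ) (hpq : f₀ p ≠ f₀ q) :
    ∃ f : ℤ × ℤ → Bool, B f ⊆ B f₀ ∧ f p ≠ f q ∧
      ∀ C ⊆ E f, (∀ e ∈ E f, e ∈ C ↔ nxt f e ∈ C) → C.Nonempty → C = E f := by
  classical
  let S : Set (ℤ × ℤ → Bool) := {f | B f ⊆ B f₀ ∧ f p ≠ f q}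
  obtain ⟨f, hf, hmin⟩ := exists_minimalFor_of_wellFoundedLT (· ∈ S) (fun f => (B f).ncard) ⟨f₀, subset_rfl, hpq⟩
  refine ⟨f, hf.1, hf.2, fun C hC hinv hne => ?_⟩
  have hBf : (B f).Finite := hfin.subset hf.1
  obtain ⟨c, hc⟩ := integrate hC hinv
  have hEB : ∀ e ∈ C, e ∈ B f := fun e he => by
    have := hC he; simp only [E, B, Set.mem_ofPred_eq] at *; rw [this.1, this.2]; simp
  have hrB : ∀ e, rev e ∈ C → e ∈ B f := fun e he => by
    have := hC he
    have h2 : (rev e).1 + D (rev e).2 = e.1 := by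
      rcases e with ⟨u, d⟩; simp [rev, add_assoc, D_rev]
    simp only [E, B, Set.mem_ofPred_eq, h2] at *
    rw [this.2]; simp only [rev] at this; rw [this.1]; simp
  have hsub : B c ⊆ B f := by
    rw [hc]; rintro e (he | he)
    exacts [hEB e he, hrB e he]
  by_cases hcp : c p = c q
  · exfalso
    let g : ℤ × ℤ → Bool := fun u => xor (f u) (c u)
    have hg : B g = B f \ B c := by
      ext e
      have := @hsub e
      simp only [B, Set.mem_ofPred_eq, Set.mem_sdiff, g] at *
      revert this
      generalize f e.1 = a1
      generalize f (e.1 + D e.2) = a2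
      generalize c e.1 = a3
      generalize c (e.1 + D e.2) = a4
      revert a1 a2 a3 a4; decide
    have hgS : g ∈ S := ⟨by rw [hg]; exact Set.sdiff_subset.trans hf.1, by
      simp only [g, hcp]; have := hf.2; revert this
      cases f p <;> cases f q <;> cases c q <;> simp⟩
    have hlt : (B g).ncard < (B f).ncard := by
      apply Set.ncard_lt_ncard _ hBf
      rw [hg]
      refine ⟨Set.sdiff_subset, fun h => ?_⟩
      obtain ⟨e, he⟩ := hne
      exact (h (hEB e he)).2 (by rw [hc]; exact Or.inl he)
    have := hmin hgS hlt.le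
    simp only at this
    omega
  · have hcS : c ∈ S := ⟨hsub.trans hf.1, hcp⟩
    have hle := hmin hcS (Set.ncard_le_ncard hsub hBf)
    have heq : B c = B f := Set.eq_of_subset_of_ncard_le hsub hle hBf
    refine hC.antisymm fun e he => ?_
    have h1 : e ∈ B f := by
      simp only [E, B, Set.mem_ofPred_eq] at *; rw [he.1, he.2]; simp
    rw [← heq, hc] at h1
    rcases h1 with h1 | h1
    · exact h1
    · have := hC h1
      simp only [E, Set.mem_ofPred_eq, rev] at *
      rw [he.2] at this; simp at this

set_option maxHeartbeats 4000000 in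
lemma lattice (i j i' j' : ℤ) (d d' : Fin 6) (α β α' β' : ℝ) (hα : 0 < α) (hα2 : α ≤ 1/2)
    (hβ : 0 ≤ β) (hβ2 : β < 1/2) (hα' : 0 < α') (hα2' : α' ≤ 1/2)
    (hβ' : 0 ≤ β') (hβ2' : β' < 1/2)
    (h1 : (i:ℝ) + α * (D d).1 + β * (D (d+1)).1 = i' + α' * (D d').1 + β' * (D (d'+1)).1)
    (h2 : (j:ℝ) + α * (D d).2 + β * (D (d+1)).2 = j' + α' * (D d').2 + β' * (D (d'+1)).2) :
    (((i',j'),d') = ((i,j),d) ∧ β = β') ∨ (i',j') = (i,j) + D d ∨ (i',j') + D d' = (i,j) := by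
  obtain ⟨m, rfl⟩ : ∃ m, i' = i + m := ⟨i' - i, by ring⟩
  obtain ⟨n, rfl⟩ : ∃ n, j' = j + n := ⟨j' - j, by ring⟩
  push_cast at h1 h2
  fin_cases d <;> fin_cases d' <;> simp [D] at h1 h2 ⊢ <;>
  · have m1 : -2 < m := by rify; linarith
    have m2 : (m:ℤ) < 2 := by rify; linarith
    have n1 : -2 < n := by rify; linarith
    have n2 : (n:ℤ) < 2 := by rify; linarith
    interval_cases m <;> interval_cases n <;> norm_num at h1 h2 ⊢ <;>
      first
      | (exfalso; linarith)
      | linarith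

noncomputable def mid (e : Ed) : ℝ × ℝ :=
  ((e.1.1 : ℝ) + (D e.2).1 / 2, (e.1.2 : ℝ) + (D e.2).2 / 2)

noncomputable def P (f : ℤ × ℤ → Bool) (e : Ed) (s : ℝ) : ℝ × ℝ :=
  mid e + s • (mid (nxt f e) - mid e)

lemma P_form (f : ℤ × ℤ → Bool) (e : Ed) (s : ℝ) :
    ∃ α : ℝ, (f (e.1 + D (e.2+1)) = true ∧ α = 1/2 ∨ f (e.1 + D (e.2+1)) = false ∧ α = (1-s)/2) ∧
    P f e s = ((e.1.1:ℝ) + α * (D e.2).1 + (s/2) * (D (e.2+1)).1,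
      (e.1.2:ℝ) + α * (D e.2).2 + (s/2) * (D (e.2+1)).2) := by
  rcases e with ⟨⟨i, j⟩, d⟩
  have h5 := D_tri' d
  have h51 : ((D d).1 : ℝ) = (D (d+1)).1 + (D (d+5)).1 := by rw [← h5]; push_cast [Prod.fst_add]; rfl
  have h52 : ((D d).2 : ℝ) = (D (d+1)).2 + (D (d+5)).2 := by rw [← h5]; push_cast [Prod.snd_add]; rfl
  cases h : f ((i,j) + D (d+1))
  · refine ⟨(1-s)/2, by simp, ?_⟩
    simp only [P, mid, nxt, h]
    ext <;> simp <;> ring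
  · refine ⟨1/2, by simp, ?_⟩
    simp only [P, mid, nxt, h]
    ext <;> simp <;> simp only [h51, h52] <;> ring

lemma P_inj {f : ℤ × ℤ → Bool} {e e' : Ed} (he : e ∈ E f) (he' : e' ∈ E f) {s s' : ℝ}
    (hs : 0 ≤ s) (hs1 : s < 1) (hs' : 0 ≤ s') (hs1' : s' < 1) (h : P f e s = P f e' s') :
    e = e' ∧ s = s' := by
  obtain ⟨α, ha, hP⟩ := P_form f e s
  obtain ⟨α', ha', hP'⟩ := P_form f e' s'
  rw [hP, hP', Prod.mk.injEq] at h
  have b : 0 < α ∧ α ≤ 1/2 := by rcases ha with ha | ha <;> constructor <;> linarith [ha.2]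
  have b' : 0 < α' ∧ α' ≤ 1/2 := by rcases ha' with ha | ha <;> constructor <;> linarith [ha.2]
  rcases e with ⟨⟨i, j⟩, d⟩
  rcases e' with ⟨⟨i', j'⟩, d'⟩
  rcases lattice i j i' j' d d' α (s/2) α' (s'/2) b.1 b.2 (by linarith) (by linarith) b'.1 b'.2
    (by linarith) (by linarith) h.1 h.2 with h | h | h
  · exact ⟨h.1.symm, by linarith [h.2]⟩
  · have h1 := he.2
    have h2 := he'.1
    simp only [h] at h1 h2; rw [h1] at h2; simp at h2
  · have h1 := he.1
    have h2 := he'.2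
    simp only [h] at h1 h2; rw [h1] at h2; simp at h2

/-- Points of the curve are close to both end points of the edge. -/
lemma P_close {f : ℤ × ℤ → Bool} {e : Ed} {s : ℝ} (hs : 0 ≤ s) (hs1 : s < 1) :
    dist (P f e s) ((e.1.1:ℝ), (e.1.2:ℝ)) ≤ 1 ∧
    dist (P f e s) (((e.1 + D e.2).1:ℝ), ((e.1 + D e.2).2:ℝ)) ≤ 1 := by
  obtain ⟨α, ha, hP⟩ := P_form f e s
  have b : 0 ≤ α ∧ α ≤ 1/2 := by rcases ha with ha | ha <;> constructor <;> linarith [ha.2]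
  obtain ⟨b1, b2⟩ := b
  rw [hP]
  clear ha hP
  rcases e with ⟨⟨i, j⟩, d⟩
  simp only [Prod.dist_eq, Real.dist_eq, sup_le_iff, abs_le]
  fin_cases d <;> simp [D] <;> refine ⟨⟨⟨?_, ?_⟩, ?_, ?_⟩, ⟨?_, ?_⟩, ?_, ?_⟩ <;> linarith

/-- hat function -/
noncomputable def φ (s t : ℝ) : ℝ := max 0 (1 - max |s| (max |t| |s + t|))

noncomputable def H (f : ℤ × ℤ → Bool) (z : ℝ × ℝ) : ℝ :=
  ∑ᶠ v : ℤ × ℤ, (if f v = true then φ (z.1 - v.1) (z.2 - v.2) else 0)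

lemma φ_zero {s t : ℝ} (h : 1 ≤ |s| ∨ 1 ≤ |t|) : φ s t = 0 := by
  unfold φ
  apply max_eq_left
  have h1 : |s| ≤ max |s| (max |t| |s + t|) := le_max_left _ _
  have h2 : |t| ≤ max |s| (max |t| |s + t|) := (le_max_left _ _).trans (le_max_right _ _)
  rcases h with h | h <;> linarith

lemma H_cont (f : ℤ × ℤ → Bool) : Continuous (H f) := by
  unfold H
  apply continuous_finsum
  · intro v
    split_ifs
    · unfold φ; fun_prop
    · fun_prop
  · intro z
    refine ⟨Metric.ball z 1, Metric.ball_mem_nhds _ one_pos, ?_⟩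
    apply (Set.finite_Icc (⌊z.1⌋ - 3, ⌊z.2⌋ - 3) (⌊z.1⌋ + 3, ⌊z.2⌋ + 3)).subset
    rintro v ⟨w, hw, hwz⟩
    have hne : φ (w.1 - v.1) (w.2 - v.2) ≠ 0 := by
      intro h; simp [h] at hw
    have h1 : |w.1 - v.1| < 1 := by
      by_contra h; exact hne (φ_zero (Or.inl (not_lt.1 h)))
    have h2 : |w.2 - v.2| < 1 := by
      by_contra h; exact hne (φ_zero (Or.inr (not_lt.1 h)))
    rw [Metric.mem_ball, Prod.dist_eq, max_lt_iff, Real.dist_eq, Real.dist_eq] at hwz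
    simp only [abs_lt] at h1 h2 hwz
    have f1 := Int.floor_le z.1
    have f2 := Int.lt_floor_add_one z.1
    have f3 := Int.floor_le z.2
    have f4 := Int.lt_floor_add_one z.2
    simp only [Set.mem_Icc, Prod.le_def]
    refine ⟨⟨?_, ?_⟩, ?_, ?_⟩ <;> rify <;> linarith

lemma H_eval (f : ℤ × ℤ → Bool) (i j : ℤ) (s t : ℝ) (hs : 0 ≤ s) (hs1 : s < 1) (ht : 0 ≤ t) (ht1 : t < 1) :
    H f (i + s, j + t) =
      (if f (i,j) = true then φ s t else 0) + (if f (i+1,j) = true then φ (s-1) t else 0)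
      + (if f (i,j+1) = true then φ s (t-1) else 0) + (if f (i+1,j+1) = true then φ (s-1) (t-1) else 0) := by
  unfold H
  rw [finsum_eq_sum_of_support_subset (s := {(i,j),(i+1,j),(i,j+1),(i+1,j+1)})]
  · rw [Finset.sum_insert (by simp), Finset.sum_insert (by simp), Finset.sum_insert (by simp), Finset.sum_singleton]
    push_cast
    have e1 : (i:ℝ) + s - (i+1) = s - 1 := by ring
    have e2 : (j:ℝ) + t - (j+1) = t - 1 := by ring
    simp only [e1, e2, add_sub_cancel_left, add_assoc]
  · rintro ⟨a, b⟩ hw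
    have hne : φ (i + s - a) (j + t - b) ≠ 0 := by
      intro h; simp [h] at hw
    have h1 : |i + s - a| < 1 := by
      by_contra h; exact hne (φ_zero (Or.inl (not_lt.1 h)))
    have h2 : |j + t - b| < 1 := by
      by_contra h; exact hne (φ_zero (Or.inr (not_lt.1 h)))
    simp only [abs_lt] at h1 h2
    have a1 : a < i + 2 := by rify; linarith
    have a2 : i - 1 < a := by rify; linarith
    have b1 : b < j + 2 := by rify; linarith
    have b2 : j - 1 < b := by rify; linarith
    simp
    omega

lemma φ_up {s t : ℝ} (hs : 0 ≤ s) (ht : 0 ≤ t) (h : s + t ≤ 1) :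
    φ s t = 1 - s - t ∧ φ (s-1) t = s ∧ φ s (t-1) = t ∧ φ (s-1) (t-1) = 0 := by
  unfold φ
  refine ⟨?_, ?_, ?_, ?_⟩ <;>
    simp only [max_def, abs] <;> split_ifs <;> linarith

lemma φ_dn {s t : ℝ} (hs : s < 1) (ht : t < 1) (h : 1 < s + t) :
    φ s t = 0 ∧ φ (s-1) t = 1 - t ∧ φ s (t-1) = 1 - s ∧ φ (s-1) (t-1) = s + t - 1 := by
  unfold φ
  refine ⟨?_, ?_, ?_, ?_⟩ <;>
    simp only [max_def, abs] <;> split_ifs <;> linarith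

lemma H_const (f : ℤ × ℤ → Bool) (z : ℝ × ℝ) (b : Bool) (h1 : f (⌊z.1⌋,⌊z.2⌋) = b)
    (h2 : f (⌊z.1⌋+1,⌊z.2⌋) = b) (h3 : f (⌊z.1⌋,⌊z.2⌋+1) = b) (h4 : f (⌊z.1⌋+1,⌊z.2⌋+1) = b) :
    H f z = if b = true then 1 else 0 := by
  have hz : z = (⌊z.1⌋ + Int.fract z.1, ⌊z.2⌋ + Int.fract z.2) := by
    ext <;> simp
  have s0 := Int.fract_nonneg z.1
  have s1 := Int.fract_lt_one z.1
  have t0 := Int.fract_nonneg z.2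
  have t1 := Int.fract_lt_one z.2
  conv_lhs => rw [hz]
  rw [H_eval f _ _ _ _ s0 s1 t0 t1, h1, h2, h3, h4]
  rcases le_or_gt (Int.fract z.1 + Int.fract z.2) 1 with h | h
  · obtain ⟨a1, a2, a3, a4⟩ := φ_up s0 t0 h
    rw [a1, a2, a3, a4]; split_ifs <;> ring
  · obtain ⟨a1, a2, a3, a4⟩ := φ_dn s1 t1 h
    rw [a1, a2, a3, a4]; split_ifs <;> ring

lemma mk_P {f : ℤ × ℤ → Bool} {z : ℝ × ℝ} (i j : ℤ) (d : Fin 6) (s : ℝ) (hs : 0 ≤ s) (hs1 : s ≤ 1)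
    (h1 : f (i,j) = true) (h2 : f ((i,j) + D d) = false)
    (b : Bool) (h3 : f ((i,j) + D (d+1)) = b)
    (hz1 : z.1 = (i:ℝ) + (if b = true then 1/2 else (1-s)/2) * (D d).1 + (s/2) * (D (d+1)).1)
    (hz2 : z.2 = (j:ℝ) + (if b = true then 1/2 else (1-s)/2) * (D d).2 + (s/2) * (D (d+1)).2) :
    ∃ e ∈ E f, ∃ s : ℝ, 0 ≤ s ∧ s ≤ 1 ∧ z = P f e s := by
  refine ⟨((i,j),d), ⟨h1, h2⟩, s, hs, hs1, ?_⟩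
  obtain ⟨α, ha, hP⟩ := P_form f ((i,j),d) s
  rw [hP]
  simp only [h3] at ha
  cases b <;> simp at ha hz1 hz2 <;> subst ha <;> ext <;> simp [hz1, hz2]

lemma H_half (f : ℤ × ℤ → Bool) (z : ℝ × ℝ) (h : H f z = 1/2) :
    ∃ e ∈ E f, ∃ s : ℝ, 0 ≤ s ∧ s ≤ 1 ∧ z = P f e s := by
  obtain ⟨i, s, s0, s1, hz1⟩ : ∃ (i : ℤ) (s : ℝ), 0 ≤ s ∧ s < 1 ∧ z.1 = i + s :=
    ⟨⌊z.1⌋, Int.fract z.1, Int.fract_nonneg _, Int.fract_lt_one _, by simp⟩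
  obtain ⟨j, t, t0, t1, hz2⟩ : ∃ (i : ℤ) (s : ℝ), 0 ≤ s ∧ s < 1 ∧ z.2 = i + s :=
    ⟨⌊z.2⌋, Int.fract z.2, Int.fract_nonneg _, Int.fract_lt_one _, by simp⟩
  have hz : z = (i + s, j + t) := by ext <;> simp [hz1, hz2]
  rw [hz, H_eval f _ _ _ _ s0 s1 t0 t1] at h
  rcases le_or_gt (s + t) 1 with hst | hst
  · obtain ⟨a1, a2, a3, a4⟩ := φ_up s0 t0 hst
    rw [a1, a2, a3, a4] at h
    cases h0 : f (i,j) <;> cases h1 : f (i+1,j) <;> cases h2 : f (i,j+1) <;>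
      simp [h0, h1, h2] at h
    -- F F F closed by simp
    · -- F F T : w -> u, d = 4
      refine mk_P i (j+1) 4 (2*s) (by linarith) (by linarith) h2 (by simpa [D] using h0) false (by simpa [D, sub_eq_add_neg] using h1) ?_ ?_ <;> simp [D, hz1, hz2] <;> linarith
    · -- F T F
      refine mk_P (i+1) j 2 (1-2*t) (by linarith) (by linarith) h1 (by simpa [D] using h2) false (by simpa [D] using h0) ?_ ?_ <;> simp [D, hz1, hz2] <;> linarith
    · -- F T T
      refine mk_P i (j+1) 4 (2*s) (by linarith) (by linarith) h2 (by simpa [D] using h0) true (by simpa [D] using h1) ?_ ?_ <;> simp [D, hz1, hz2] <;> linarith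
    · -- T F F
      refine mk_P i j 0 (2*t) (by linarith) (by linarith) h0 (by simpa [D] using h1) false (by simpa [D] using h2) ?_ ?_ <;> simp [D, hz1, hz2] <;> linarith
    · -- T F T
      refine mk_P i j 0 (2*t) (by linarith) (by linarith) h0 (by simpa [D] using h1) true (by simpa [D] using h2) ?_ ?_ <;> simp [D, hz1, hz2] <;> linarith
    · -- T T F
      refine mk_P (i+1) j 2 (1-2*s) (by linarith) (by linarith) h1 (by simpa [D] using h2) true (by simpa [D] using h0) ?_ ?_ <;> simp [D, hz1, hz2] <;> linarith
    · linarith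
  · obtain ⟨a1, a2, a3, a4⟩ := φ_dn s1 t1 hst
    rw [a1, a2, a3, a4] at h
    -- triangle u = (i+1,j), v = (i+1,j+1), w = (i,j+1), d = 1
    cases h0 : f (i+1,j) <;> cases h1 : f (i+1,j+1) <;> cases h2 : f (i,j+1) <;>
      simp [h0, h1, h2] at h
    · refine mk_P i (j+1) 5 (2*(s+t-1)) (by linarith) (by linarith) h2 (by simpa [D] using h0) false (by simpa [D] using h1) ?_ ?_ <;> simp [D, hz1, hz2] <;> linarith
    · refine mk_P (i+1) (j+1) 3 (2*(1-t)) (by linarith) (by linarith) h1 (by simpa [D] using h2) false (by simpa [D] using h0) ?_ ?_ <;> simp [D, hz1, hz2] <;> linarith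
    · refine mk_P i (j+1) 5 (2*(s+t-1)) (by linarith) (by linarith) h2 (by simpa [D] using h0) true (by simpa [D] using h1) ?_ ?_ <;> simp [D, hz1, hz2] <;> linarith
    · refine mk_P (i+1) j 1 (2*(1-s)) (by linarith) (by linarith) h0 (by simpa [D] using h1) false (by simpa [D] using h2) ?_ ?_ <;> simp [D, hz1, hz2] <;> linarith
    · refine mk_P (i+1) j 1 (2*(1-s)) (by linarith) (by linarith) h0 (by simpa [D] using h1) true (by simpa [D] using h2) ?_ ?_ <;> simp [D, hz1, hz2] <;> linarith
    · refine mk_P (i+1) (j+1) 3 (2*(1-t)) (by linarith) (by linarith) h1 (by simpa [D] using h2) true (by simpa [D] using h0) ?_ ?_ <;> simp [D, hz1, hz2] <;> linarith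
    · linarith

end JC
namespace JC

lemma P_zero (f : ℤ × ℤ → Bool) (e : Ed) : P f e 0 = mid e := by simp [P]
lemma P_one (f : ℤ × ℤ → Bool) (e : Ed) : P f e 1 = mid (nxt f e) := by simp [P]

lemma loop {f : ℤ × ℤ → Bool} (hfin : (E f).Finite) (hne : (E f).Nonempty)
    (hmin : ∀ C ⊆ E f, (∀ e ∈ E f, e ∈ C ↔ nxt f e ∈ C) → C.Nonempty → C = E f) :
    ∃ γ : Circle → ℝ × ℝ, Continuous γ ∧ Function.Injective γ ∧
      (∀ w, ∃ e ∈ E f, ∃ s : ℝ, 0 ≤ s ∧ s < 1 ∧ γ w = P f e s) ∧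
      (∀ e ∈ E f, ∀ s : ℝ, 0 ≤ s → s ≤ 1 → P f e s ∈ Set.range γ) := by
  obtain ⟨e₀', he₀⟩ := hne
  have : Finite (E f) := hfin
  let e₀ : E f := ⟨e₀', he₀⟩
  let k (n : ℤ) : E f := (σ f ^ n) e₀
  have hk1 : ∀ n, ((k (n+1) : E f) : Ed) = nxt f (k n) := by
    intro n; simp only [k, add_comm n 1, zpow_add, zpow_one, Equiv.Perm.mul_apply]; rfl
  -- surjectivity
  have hsurj : ∀ e ∈ E f, ∃ n, (k n : Ed) = e := by
    have := hmin {e | ∃ n, (k n : Ed) = e} (by rintro e ⟨n, rfl⟩; exact (k n).2) (by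
      intro e he
      constructor
      · rintro ⟨n, rfl⟩; exact ⟨n+1, hk1 n⟩
      · rintro ⟨n, hn⟩
        refine ⟨n-1, ?_⟩
        have h1 := hk1 (n-1)
        rw [sub_add_cancel, hn] at h1
        have h2 := congrArg (prv f) h1
        rw [prv_nxt he, prv_nxt (k (n-1)).2] at h2
        exact h2.symm) ⟨_, 0, rfl⟩
    intro e he
    rw [← this] at he; exact he
  obtain ⟨p, hp0, hp⟩ : ∃ p : ℕ, 0 < p ∧ ∀ a b : ℤ, k a = k b ↔ (p:ℤ) ∣ a - b := by
    refine ⟨MulAction.period (σ f) e₀, ?_, ?_⟩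
    · exact MulAction.period_pos_of_orderOf_pos (orderOf_pos _) _
    · intro a b
      rw [← MulAction.zpow_smul_eq_iff_period_dvd, Equiv.Perm.smul_def, sub_eq_neg_add, zpow_add, zpow_neg,
        Equiv.Perm.mul_apply, Equiv.Perm.inv_eq_iff_eq]
      
  let g : ℝ → ℝ × ℝ := fun t => P f (k ⌊t⌋) (Int.fract t)
  have hgIcc : ∀ n : ℤ, ∀ t ∈ Set.Icc (n:ℝ) (n+1), g t = P f (k n) (t - n) := by
    intro n t ht
    rcases lt_or_eq_of_le ht.2 with h | h
    · have : ⌊t⌋ = n := Int.floor_eq_iff.2 ⟨ht.1, h⟩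
      simp only [g, Int.fract, this]
    · have : ⌊t⌋ = n + 1 := by rw [h]; exact_mod_cast Int.floor_intCast (R := ℝ) (n+1)
      simp only [g, Int.fract, this]
      rw [hk1]
      subst h
      push_cast
      rw [sub_self, add_sub_cancel_left, P_zero, P_one]
  have hgc : Continuous g := by
    refine LocallyFinite.continuous (f := fun n : ℤ => Set.Icc (n:ℝ) (n+1)) ?_ ?_ (fun n => isClosed_Icc) ?_
    · intro x
      refine ⟨Set.Ioo (x-1) (x+1), Ioo_mem_nhds (by linarith) (by linarith), ?_⟩
      apply (Set.finite_Icc (⌊x⌋-3) (⌊x⌋+3)).subset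
      rintro n ⟨t, ht, ht2⟩
      simp only [Set.mem_Icc, Set.mem_Ioo] at *
      have f1 := Int.floor_le x
      have f2 := Int.lt_floor_add_one x
      constructor <;> rify <;> linarith
    · rw [Set.eq_univ_iff_forall]
      intro x
      exact Set.mem_iUnion.2 ⟨⌊x⌋, Int.floor_le x, (Int.lt_floor_add_one x).le⟩
    · intro n
      refine ContinuousOn.congr ?_ (hgIcc n)
      apply Continuous.continuousOn
      unfold P; fun_prop
  have hper : Function.Periodic g (p:ℝ) := by
    intro t
    simp only [g]
    have h1 : ⌊t + (p:ℝ)⌋ = ⌊t⌋ + p := Int.floor_add_natCast t p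
    have h2 : Int.fract (t + (p:ℝ)) = Int.fract t := Int.fract_add_natCast t p
    rw [h1, h2, (hp (⌊t⌋ + p) ⌊t⌋).2 (by simp)]
  have hinj : ∀ t t', g t = g t' → ∃ m : ℤ, t - t' = m * p := by
    intro t t' h
    obtain ⟨h1, h2⟩ := P_inj (k ⌊t⌋).2 (k ⌊t'⌋).2 (Int.fract_nonneg _) (Int.fract_lt_one _)
      (Int.fract_nonneg _) (Int.fract_lt_one _) h
    obtain ⟨m, hm⟩ := (hp _ _).1 (Subtype.ext h1)
    refine ⟨m, ?_⟩
    have := Int.self_sub_floor t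
    have h3 := Int.self_sub_floor t'
    have h4 : (⌊t⌋:ℝ) - ⌊t'⌋ = p * m := by exact_mod_cast hm
    linarith
  have hp' : (p:ℝ) ≠ 0 := by positivity
  let G : AddCircle (p:ℝ) → ℝ × ℝ := hper.lift
  have hGc : Continuous G := continuous_quot_lift _ hgc
  have hGi : Function.Injective G := by
    intro a b
    induction a using QuotientAddGroup.induction_on with | H a => ?_
    induction b using QuotientAddGroup.induction_on with | H b => ?_
    intro h
    obtain ⟨m, hm⟩ := hinj a b h
    rw [← sub_eq_zero]
    change ((a - b : ℝ) : AddCircle (p:ℝ)) = 0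
    rw [AddCircle.coe_eq_zero_iff]
    exact ⟨m, by rw [hm]; simp⟩
  let Θ := (AddCircle.homeomorphCircle hp').symm
  refine ⟨G ∘ Θ, hGc.comp Θ.continuous, hGi.comp Θ.injective, ?_, ?_⟩
  · intro w
    obtain ⟨t, ht⟩ := QuotientAddGroup.mk_surjective (Θ w)
    refine ⟨k ⌊t⌋, (k ⌊t⌋).2, Int.fract t, Int.fract_nonneg _, Int.fract_lt_one _, ?_⟩
    simp only [Function.comp]
    rw [← ht]; rfl
  · intro e he s hs hs1
    obtain ⟨n, rfl⟩ := hsurj e he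
    have := hgIcc n (n + s) ⟨by linarith, by linarith⟩
    rw [add_sub_cancel_left] at this
    refine ⟨Θ.symm ((n + s : ℝ) : AddCircle (p:ℝ)), ?_⟩
    simp only [Function.comp, Homeomorph.apply_symm_apply]
    exact this

lemma path_nonempty {f : ℤ × ℤ → Bool} (h : E f = ∅) (p q : ℤ × ℤ) : f p = f q := by
  have hstep : ∀ u d, f u = f (u + D d) := by
    intro u d
    by_contra hne
    cases h1 : f u <;> cases h2 : f (u + D d)
    · simp [h1, h2] at hne
    · have : (u + D d, d + 3) ∈ E f := ⟨h2, by simpa [add_assoc, D_rev] using h1⟩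
      rw [h] at this; exact this
    · have : (u, d) ∈ E f := ⟨h1, h2⟩
      rw [h] at this; exact this
    · simp [h1, h2] at hne
  have hx : ∀ i j : ℤ, f (i,j) = f (0,j) := by
    intro i j
    induction i using Int.induction_on with
    | zero => rfl
    | succ n ih => rw [← ih, hstep (n,j) 0]; simp [D]
    | pred n ih => rw [← ih, hstep (-n,j) 3]; simp [D, sub_eq_add_neg]
  have hy : ∀ j : ℤ, f (0,j) = f (0,0) := by
    intro j
    induction j using Int.induction_on with
    | zero => rfl
    | succ n ih => rw [← ih, hstep (0,n) 1]; simp [D]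
    | pred n ih => rw [← ih, hstep (0,-n) 4]; simp [D, sub_eq_add_neg]
  rw [← Prod.mk.eta (p := p), ← Prod.mk.eta (p := q), hx p.1, hx q.1, hy p.2, hy q.2]

lemma core (A K : Set (ℝ × ℝ)) (hA : Bornology.IsBounded A)
    (hAK : ∀ a ∈ A, ∀ b ∈ K, 2 < dist a b) (x y : ℝ × ℝ) (hx : x ∈ A) (hy : y ∈ K) :
    ∃ γ : Circle → ℝ × ℝ, Continuous γ ∧ Function.Injective γ ∧
      (∀ w, γ w ∉ A ∧ γ w ∉ K) ∧
      ∀ S : Set (ℝ × ℝ), IsPreconnected S → x ∈ S → y ∈ S → ∃ w, γ w ∈ S := by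
  classical
  let c : ℤ × ℤ → ℝ × ℝ := fun u => ((u.1:ℝ), (u.2:ℝ))
  let f₀ : ℤ × ℤ → Bool := fun u => decide (∃ a ∈ A, dist (c u) a ≤ 1)
  have hf0 : ∀ u, f₀ u = true ↔ ∃ a ∈ A, dist (c u) a ≤ 1 := fun u => by simp [f₀]
  have nearA : ∀ u z, z ∈ A → dist z (c u) ≤ 1 → f₀ u = true := fun u z hz h =>
    (hf0 u).2 ⟨z, hz, by rwa [dist_comm]⟩
  have nearK : ∀ u z, z ∈ K → dist z (c u) ≤ 1 → f₀ u = false := fun u z hz h => by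
    by_contra hne
    obtain ⟨a, ha, had⟩ := (hf0 u).1 (by simpa using hne)
    have := hAK a ha z hz
    have h3 := dist_triangle_right a z (c u)
    rw [dist_comm a (c u)] at h3
    linarith
  have hF : {u | f₀ u = true}.Finite := by
    obtain ⟨R, hR⟩ := hA.subset_closedBall (0 : ℝ × ℝ)
    apply (Set.finite_Icc (⌊-R-2⌋, ⌊-R-2⌋) (⌈R+2⌉, ⌈R+2⌉)).subset
    intro u hu
    obtain ⟨a, ha, had⟩ := (hf0 u).1 hu
    have h1 := hR ha
    rw [Metric.mem_closedBall, Prod.dist_eq, max_le_iff, Real.dist_eq, Real.dist_eq] at h1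
    rw [Prod.dist_eq, max_le_iff, Real.dist_eq, Real.dist_eq] at had
    simp only [abs_le, c, Prod.fst_zero, Prod.snd_zero] at h1 had
    have g1 := Int.floor_le (-R-2)
    have g2 := Int.le_ceil (R+2)
    simp only [Set.mem_Icc, Prod.le_def]
    refine ⟨⟨?_, ?_⟩, ?_, ?_⟩ <;> rify <;> linarith
  have hB : (B f₀).Finite := by
    have h1 : ({u | f₀ u = true} ×ˢ (Set.univ : Set (Fin 6))).Finite := hF.prod Set.finite_univ
    apply (h1.union (h1.image rev)).subset
    rintro ⟨u, d⟩ he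
    simp only [B, Set.mem_ofPred_eq] at he
    cases h : f₀ u
    · right
      refine ⟨rev (u,d), ⟨?_, trivial⟩, rev_rev _⟩
      rw [h] at he
      simpa [rev] using he.symm
    · left; exact ⟨h, trivial⟩
  have corner : ∀ z : ℝ × ℝ, ∀ u : ℤ × ℤ, (u.1 = ⌊z.1⌋ ∨ u.1 = ⌊z.1⌋ + 1) →
      (u.2 = ⌊z.2⌋ ∨ u.2 = ⌊z.2⌋ + 1) → dist z (c u) ≤ 1 := by
    intro z u h1 h2
    have f1 := Int.floor_le z.1
    have f2 := Int.lt_floor_add_one z.1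
    have f3 := Int.floor_le z.2
    have f4 := Int.lt_floor_add_one z.2
    rw [Prod.dist_eq, max_le_iff, Real.dist_eq, Real.dist_eq, abs_le, abs_le]
    simp only [c]
    rcases h1 with h1 | h1 <;> rcases h2 with h2 | h2 <;> rw [h1, h2] <;> push_cast <;>
      refine ⟨⟨?_, ?_⟩, ?_, ?_⟩ <;> linarith
  have hxc : f₀ (⌊x.1⌋, ⌊x.2⌋) = true := nearA _ x hx (corner _ _ (by simp) (by simp))
  have hyc : f₀ (⌊y.1⌋, ⌊y.2⌋) = false := nearK _ y hy (corner _ _ (by simp) (by simp))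
  obtain ⟨f, hBf, hpq, hmin⟩ := exists_min f₀ hB (⌊x.1⌋, ⌊x.2⌋) (⌊y.1⌋, ⌊y.2⌋) (by rw [hxc, hyc]; simp)
  have hEB : E f ⊆ B f := fun e he => by
    simp only [E, B, Set.mem_ofPred_eq] at *; rw [he.1, he.2]; simp
  have hEne : (E f).Nonempty := by
    by_contra h
    exact hpq (path_nonempty (Set.not_nonempty_iff_eq_empty.1 h) _ _)
  obtain ⟨γ, hγc, hγi, hγ1, hγ2⟩ := loop (hB.subset (hEB.trans hBf)) hEne hmin
  have hconst : ∀ z : ℝ × ℝ, ∀ b : Bool, (∀ u : ℤ × ℤ, dist z (c u) ≤ 1 → f₀ u = b) →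
      H f z = if f (⌊z.1⌋, ⌊z.2⌋) = true then 1 else 0 := by
    intro z b hz
    have hstep : ∀ u d, dist z (c u) ≤ 1 → dist z (c (u + D d)) ≤ 1 → f (u + D d) = f u := by
      intro u d h1 h2
      by_contra hne
      have : (u,d) ∈ B f := fun h => hne h.symm
      exact hBf this ((hz _ h1).trans (hz _ h2).symm)
    have c00 := corner z (⌊z.1⌋, ⌊z.2⌋) (by simp) (by simp)
    have c10 := corner z (⌊z.1⌋+1, ⌊z.2⌋) (by simp) (by simp)
    have c01 := corner z (⌊z.1⌋, ⌊z.2⌋+1) (by simp) (by simp)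
    have c11 := corner z (⌊z.1⌋+1, ⌊z.2⌋+1) (by simp) (by simp)
    have s1 : f (⌊z.1⌋+1, ⌊z.2⌋) = f (⌊z.1⌋, ⌊z.2⌋) := by
      simpa [D] using hstep (⌊z.1⌋, ⌊z.2⌋) 0 c00 (by simpa [D] using c10)
    have s2 : f (⌊z.1⌋, ⌊z.2⌋+1) = f (⌊z.1⌋, ⌊z.2⌋) := by
      simpa [D] using hstep (⌊z.1⌋, ⌊z.2⌋) 1 c00 (by simpa [D] using c01)
    have s3 : f (⌊z.1⌋+1, ⌊z.2⌋+1) = f (⌊z.1⌋, ⌊z.2⌋+1) := by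
      simpa [D] using hstep (⌊z.1⌋, ⌊z.2⌋+1) 0 c01 (by simpa [D] using c11)
    exact H_const f z _ rfl s1 s2 (s3.trans s2)
  have Hx := hconst x true (fun u h => nearA u x hx h)
  have Hy := hconst y false (fun u h => nearK u y hy h)
  refine ⟨γ, hγc, hγi, ?_, ?_⟩
  · intro w
    obtain ⟨e, he, s, hs, hs1, hw⟩ := hγ1 w
    have hcl := P_close (f := f) (e := e) hs hs1
    have hb : f₀ e.1 ≠ f₀ (e.1 + D e.2) := hBf (hEB he)
    rw [hw]
    refine ⟨fun h => hb ?_, fun h => hb ?_⟩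
    · rw [nearA _ _ h hcl.1, nearA _ _ h hcl.2]
    · rw [nearK _ _ h hcl.1, nearK _ _ h hcl.2]
  · intro S hS hxS hyS
    have : ∃ z ∈ S, H f z = 1/2 := by
      cases h1 : f (⌊x.1⌋, ⌊x.2⌋) <;> cases h2 : f (⌊y.1⌋, ⌊y.2⌋) <;> rw [h1] at Hx <;> rw [h2] at Hy
      · exact absurd (h1.trans h2.symm) hpq
      · exact hS.intermediate_value hxS hyS (H_cont f).continuousOn (by rw [Hx, Hy]; norm_num)
      · exact hS.intermediate_value hyS hxS (H_cont f).continuousOn (by rw [Hx, Hy]; norm_num)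
      · exact absurd (h1.trans h2.symm) hpq
    obtain ⟨z, hzS, hz⟩ := this
    obtain ⟨e, he, s, hs, hs1, rfl⟩ := H_half f z hz
    obtain ⟨w, hw⟩ := hγ2 e he s hs hs1
    exact ⟨w, hw ▸ hzS⟩

end JC

theorem stmt8 (K : Set (EuclideanSpace ℝ (Fin 2))) (hK : IsCompact K)
    (x y : EuclideanSpace ℝ (Fin 2)) (hx : x ∈ K) (hy : y ∈ K)
    (hxy : connectedComponentIn K x ≠ connectedComponentIn K y) :
    ∃ Γ : Set (EuclideanSpace ℝ (Fin 2)), IsJordanCurve Γ ∧ Disjoint Γ K ∧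
      connectedComponentIn Γᶜ x ≠ connectedComponentIn Γᶜ y := by
  classical
  have : CompactSpace K := isCompact_iff_compactSpace.1 hK
  obtain ⟨U, hU, hxU, hyU⟩ : ∃ U : Set K, IsClopen U ∧ (⟨x,hx⟩ : K) ∈ U ∧ (⟨y,hy⟩ : K) ∉ U := by
    by_contra hcon
    push Not at hcon
    apply hxy
    rw [connectedComponentIn_eq_image hx, connectedComponentIn_eq_image hy]
    congr 1
    apply connectedComponent_eq
    rw [connectedComponent_eq_iInter_isClopen]
    exact Set.mem_iInter.2 fun s => hcon s.1 s.2.1 s.2.2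
  let Φ₀ : EuclideanSpace ℝ (Fin 2) ≃ₜ ℝ × ℝ :=
    Complex.orthonormalBasisOneI.repr.symm.toHomeomorph.trans Complex.equivRealProdCLM.toHomeomorph
  let ι : K → ℝ × ℝ := fun z => Φ₀ z
  have hι : Continuous ι := Φ₀.continuous.comp continuous_subtype_val
  have hιi : Function.Injective ι := Φ₀.injective.comp Subtype.val_injective
  have hA0 : IsCompact (ι '' U) := hU.1.isCompact.image hι
  have hB0 : IsCompact (ι '' Uᶜ) := hU.compl.1.isCompact.image hι
  have hdis : Disjoint (ι '' U) (ι '' Uᶜ) := by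
    rw [Set.disjoint_image_iff hιi]; exact disjoint_compl_right
  obtain ⟨δ, hδ, hth⟩ := hdis.exists_thickenings hA0 hB0.isClosed
  have hdist : ∀ a ∈ ι '' U, ∀ b ∈ ι '' Uᶜ, δ ≤ dist a b := by
    intro a ha b hb
    by_contra h
    exact Set.disjoint_left.1 hth (Metric.self_subset_thickening hδ _ ha)
      (Metric.mem_thickening_iff.2 ⟨b, hb, not_le.1 h⟩)
  have hc : (3/δ : ℝ) ≠ 0 := by positivity
  let Φ : EuclideanSpace ℝ (Fin 2) ≃ₜ ℝ × ℝ := Φ₀.trans (Homeomorph.smulOfNeZero (3/δ) hc)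
  have hΦ : ∀ z, Φ z = (3/δ) • Φ₀ z := fun z => rfl
  obtain ⟨γ, hγc, hγi, hγd, hγs⟩ := JC.core ((fun z : K => Φ z) '' U) ((fun z : K => Φ z) '' Uᶜ)
    (hU.1.isCompact.image (Φ.continuous.comp continuous_subtype_val)).isBounded (by
      rintro _ ⟨a, ha, rfl⟩ _ ⟨b, hb, rfl⟩
      simp only [hΦ, dist_smul₀]
      have h1 := hdist _ ⟨a, ha, rfl⟩ _ ⟨b, hb, rfl⟩
      simp only [ι] at h1
      rw [Real.norm_of_nonneg (by positivity)]
      have : 3/δ * δ ≤ 3/δ * dist (Φ₀ a) (Φ₀ b) := by gcongr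
      rw [div_mul_cancel₀ _ hδ.ne'] at this
      linarith) (Φ x) (Φ y) ⟨_, hxU, rfl⟩ ⟨_, hyU, rfl⟩
  let γ' : Circle → EuclideanSpace ℝ (Fin 2) := Φ.symm ∘ γ
  have hemb : Topology.IsEmbedding γ' :=
    ((Φ.symm.continuous.comp hγc).isClosedEmbedding (Φ.symm.injective.comp hγi)).isEmbedding
  have hdisj : Disjoint (Set.range γ') K := by
    rw [Set.disjoint_left]
    rintro _ ⟨w, rfl⟩ hwK
    have h := hγd w
    have hw : γ w = Φ (γ' w) := by simp [γ']
    by_cases hwU : (⟨γ' w, hwK⟩ : K) ∈ U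
    · exact h.1 ⟨_, hwU, hw.symm⟩
    · exact h.2 ⟨_, hwU, hw.symm⟩
  refine ⟨Set.range γ', ⟨?_⟩, hdisj, ?_⟩
  · refine hemb.toHomeomorph.symm.trans ?_
    refine Homeomorph.subtype (p := fun z : ℂ => z ∈ Submonoid.unitSphere ℂ) Complex.orthonormalBasisOneI.repr.toHomeomorph ?_
    intro z
    simp [Submonoid.unitSphere]
  · intro heq
    have hxΓ : x ∈ (Set.range γ')ᶜ := fun h => Set.disjoint_left.1 hdisj h hx
    have hyΓ : y ∈ (Set.range γ')ᶜ := fun h => Set.disjoint_left.1 hdisj h hy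
    have h1 := mem_connectedComponentIn hxΓ
    have h2 := mem_connectedComponentIn hyΓ
    rw [← heq] at h2
    have hpre : IsPreconnected (connectedComponentIn (Set.range γ')ᶜ x) := isPreconnected_connectedComponentIn
    obtain ⟨w, z, hz, hzw⟩ := hγs (Φ '' connectedComponentIn (Set.range γ')ᶜ x)
      (hpre.image _ Φ.continuous.continuousOn) ⟨x, h1, rfl⟩ ⟨y, h2, rfl⟩
    exact connectedComponentIn_subset _ _ hz ⟨w, by simp [γ', ← hzw]⟩
end

section
/- Let U ⊆ ℝ² be a Jordan domain (the bounded component of the complement of a Jordan curve) and K ⊆ cl(U) a continuum (nonempty connected compact set). If a, b ∈ ∂U lie in different connected components of ∂U \ K, then a and b lie in different connected components of cl(U) \ K. -/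
/-- A Jordan domain: the bounded connected component of the complement of a
Jordan curve. -/
def IsJordanDomain (U : Set (EuclideanSpace ℝ (Fin 2))) : Prop :=
  ∃ (Γ : Set (EuclideanSpace ℝ (Fin 2))) (z : EuclideanSpace ℝ (Fin 2)),
    IsJordanCurve Γ ∧ z ∈ Γᶜ ∧ U = connectedComponentIn Γᶜ z ∧ Bornology.IsBounded U

open Set Filter Topology

namespace JD

lemma exp_lift_eq {α : Type*} [TopologicalSpace α] {s : Set α} (hs : IsPreconnected s)
    {g₁ g₂ : α → ℂ} (h₁ : ContinuousOn g₁ s) (h₂ : ContinuousOn g₂ s)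
    (he : ∀ x ∈ s, Complex.exp (g₁ x) = Complex.exp (g₂ x)) {a : α} (ha : a ∈ s)
    (hga : g₁ a = g₂ a) : ∀ x ∈ s, g₁ x = g₂ x :=
  Complex.isCoveringMap_exp.eqOn_of_comp_eqOn hs h₁ h₂
    (fun x hx => Subtype.ext (he x hx)) ha hga

lemma exists_log {A : Type*} [TopologicalSpace A] [SimplyConnectedSpace A]
    [LocallyPathConnectedSpace A] (F : A → ℂ) (hF : Continuous F) (h0 : ∀ x, F x ≠ 0) :
    ∃ H : A → ℂ, Continuous H ∧ ∀ x, Complex.exp (H x) = F x := by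
  obtain ⟨a₀⟩ : Nonempty A := inferInstance
  obtain ⟨G, ⟨-, hG⟩, -⟩ := Complex.isCoveringMap_exp.existsUnique_continuousMap_lifts
    (⟨fun x => ⟨F x, h0 x⟩, by fun_prop⟩ : C(A, {z : ℂ // z ≠ 0})) a₀ (Complex.log (F a₀))
    (Subtype.ext (by simp [Complex.exp_log (h0 a₀)]))
  exact ⟨G, G.continuous, fun x => congrArg Subtype.val (congrFun hG x)⟩

def HasLog (X : Set ℂ) (z : ℂ) : Prop :=
  ∃ g : ℂ → ℂ, ContinuousOn g X ∧ ∀ x ∈ X, Complex.exp (g x) = x - z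

lemma HasLog.mono {X Y : Set ℂ} {z : ℂ} (h : HasLog Y z) (hXY : X ⊆ Y) : HasLog X z := by
  obtain ⟨g, hg, he⟩ := h
  exact ⟨g, hg.mono hXY, fun x hx => he x (hXY hx)⟩

lemma HasLog.not_mem {X : Set ℂ} {z : ℂ} (h : HasLog X z) : z ∉ X := by
  obtain ⟨g, hg, he⟩ := h
  intro hz
  have := he z hz
  simp [Complex.exp_ne_zero] at this

lemma HasLog.move {X : Set ℂ} {p q : ℂ} (h : HasLog X p) (hd : ∀ x ∈ X, dist p q < dist x p) :
    HasLog X q := by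
  have hnm := h.not_mem
  obtain ⟨g, hg, he⟩ := h
  have hne : ∀ x ∈ X, x - p ≠ 0 := fun x hx h0 => hnm (by rwa [← sub_eq_zero.1 h0])
  have hsl : ∀ x ∈ X, 1 + (p - q) / (x - p) ∈ Complex.slitPlane := by
    intro x hx
    apply Complex.mem_slitPlane_of_norm_lt_one
    rw [norm_div, div_lt_one (norm_pos_iff.2 (hne x hx))]
    simpa [dist_eq_norm] using hd x hx
  refine ⟨fun x => g x + Complex.log (1 + (p - q) / (x - p)), ?_, ?_⟩
  · refine hg.add (ContinuousOn.clog ?_ hsl)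
    exact continuousOn_const.add (continuousOn_const.div (by fun_prop) hne)
  · intro x hx
    rw [Complex.exp_add, he x hx, Complex.exp_log (Complex.slitPlane_ne_zero (hsl x hx))]
    have := hne x hx
    field_simp
    ring

lemma hasLog_loc {X : Set ℂ} (hX : IsClosed X) {p : ℂ} (hp : p ∉ X) :
    ∃ r > 0, ∀ q ∈ Metric.ball p r, ∀ q' ∈ Metric.ball p r, HasLog X q → HasLog X q' := by
  obtain ⟨r, hr, hb⟩ := Metric.isOpen_iff.1 hX.isOpen_compl p hp
  refine ⟨r / 3, by positivity, fun q hq q' hq' h => h.move fun x hx => ?_⟩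
  have h1 : r ≤ dist x p := by
    by_contra! hlt
    exact hb (Metric.mem_ball.2 hlt) hx
  rw [Metric.mem_ball] at hq hq'
  have h2 := dist_triangle x q p
  have h3 := dist_triangle_right q q' p
  linarith

lemma isOpen_hasLog {X : Set ℂ} (hX : IsClosed X) : IsOpen {z | HasLog X z} := by
  rw [Metric.isOpen_iff]
  intro p hp
  obtain ⟨r, hr, h⟩ := hasLog_loc hX (HasLog.not_mem hp)
  exact ⟨r, hr, fun q hq => h p (Metric.mem_ball_self hr) q hq hp⟩

lemma isOpen_not_hasLog {X : Set ℂ} (hX : IsClosed X) : IsOpen {z | z ∉ X ∧ ¬ HasLog X z} := by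
  rw [Metric.isOpen_iff]
  rintro p ⟨hp, hn⟩
  obtain ⟨r, hr, h⟩ := hasLog_loc hX hp
  obtain ⟨r', hr', hb⟩ := Metric.isOpen_iff.1 hX.isOpen_compl p hp
  refine ⟨min r r', by positivity, fun q hq => ⟨hb (Metric.ball_subset_ball (min_le_right _ _) hq),
    fun hq' => hn (h q (Metric.ball_subset_ball (min_le_left _ _) hq) p
      (Metric.mem_ball_self hr) hq')⟩⟩

lemma hasLog_far {X : Set ℂ} (hX : Bornology.IsBounded X) :
    ∃ R : ℝ, ∀ z : ℂ, R < ‖z‖ → HasLog X z := by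
  obtain ⟨R, hR⟩ := hX.exists_norm_le
  refine ⟨R, fun z hz => ?_⟩
  have hx : ∀ x ∈ X, ‖x‖ < ‖z‖ := fun x hx => (hR x hx).trans_lt hz
  by_cases hz0 : z = 0
  · refine ⟨id, continuousOn_id, fun x hxX => ?_⟩
    have := hx x hxX
    simp [hz0] at this
    exact absurd this (by simp)
  have hsl : ∀ x ∈ X, 1 + (- x / z) ∈ Complex.slitPlane := by
    intro x hxX
    apply Complex.mem_slitPlane_of_norm_lt_one
    rw [norm_div, div_lt_one (norm_pos_iff.2 hz0), norm_neg]
    exact hx x hxX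
  refine ⟨fun x => Complex.log (-z) + Complex.log (1 + (-x / z)), ?_, ?_⟩
  · exact continuousOn_const.add (ContinuousOn.clog (by fun_prop) hsl)
  · intro x hxX
    rw [Complex.exp_add, Complex.exp_log (neg_ne_zero.2 hz0),
      Complex.exp_log (Complex.slitPlane_ne_zero (hsl x hxX))]
    field_simp
    ring

lemma HasLog.union {X Y : Set ℂ} {z : ℂ} (hXc : IsClosed X) (hYc : IsClosed Y)
    (hc : IsConnected (X ∩ Y)) (hX : HasLog X z) (hY : HasLog Y z) : HasLog (X ∪ Y) z := by
  classical
  obtain ⟨⟨c, hcX, hcY⟩, hconn⟩ := hc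
  obtain ⟨g, hg, hge⟩ := hX
  obtain ⟨k, hk, hke⟩ := hY
  have hE : Complex.exp (g c - k c) = 1 := by
    rw [Complex.exp_sub, hge c hcX, hke c hcY, ← hke c hcY, div_self (Complex.exp_ne_zero _)]
  have key : ∀ x ∈ X ∩ Y, g x = k x + (g c - k c) := by
    refine exp_lift_eq hconn (hg.mono inter_subset_left)
      ((hk.mono inter_subset_right).add continuousOn_const) ?_ ⟨hcX, hcY⟩ (by ring)
    intro x hx
    rw [Complex.exp_add, hE, mul_one, hge x hx.1, hke x hx.2]
  have e1 : EqOn (fun x => if x ∈ X then g x else k x + (g c - k c)) g X := by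
    intro x hx
    simp [hx]
  have e2 : EqOn (fun x => if x ∈ X then g x else k x + (g c - k c))
      (fun x => k x + (g c - k c)) Y := by
    intro x hx
    by_cases h : x ∈ X
    · simpa [h] using key x ⟨h, hx⟩
    · simp [h]
  refine ⟨fun x => if x ∈ X then g x else k x + (g c - k c), ?_, ?_⟩
  · exact ContinuousOn.union_of_isClosed (hg.congr e1) ((hk.add continuousOn_const).congr e2) hXc hYc
  · rintro x (hx | hx)
    · rw [e1 hx, hge x hx]
    · rw [e2 hx]
      simp only
      rw [Complex.exp_add, hE, mul_one, hke x hx]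

lemma not_hasLog {X V : Set ℂ} (hX : IsClosed X) (hV : Bornology.IsBounded V)
    (hf : frontier V ⊆ X) {z : ℂ} (hz : z ∈ V) : ¬ HasLog X z := by
  classical
  rintro ⟨g, hg, he⟩
  obtain ⟨G, hG⟩ := ContinuousMap.exists_restrict_eq hX
    (⟨X.domRestrict g, continuousOn_iff_continuous_domRestrict.1 hg⟩ : C(X, ℂ))
  have hG' : ∀ x ∈ X, G x = g x := fun x hx => congrFun (congrArg DFunLike.coe hG) ⟨x, hx⟩
  let F : ℂ → ℂ := fun x => if x ∈ V then Complex.exp (G x) else x - z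
  have hFc : Continuous F := by
    refine continuous_if ?_ ?_ ?_
    · intro x hx
      rw [hG' x (hf hx), he x (hf hx)]
    · exact (Complex.continuous_exp.comp G.continuous).continuousOn
    · fun_prop
  have hF0 : ∀ x, F x ≠ 0 := by
    intro x
    by_cases hx : x ∈ V
    · simp [F, hx, Complex.exp_ne_zero]
    · simp only [F, hx, if_false]
      intro h
      exact hx (by rwa [sub_eq_zero.1 h])
  obtain ⟨H, hHc, hH⟩ := exists_log F hFc hF0
  obtain ⟨R, hR⟩ := hV.exists_norm_le
  let S : ℝ := |R| + ‖z‖ + 1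
  have hSpos : 0 < S := by positivity
  have hout : ∀ t : ℝ, z + S * Complex.exp (t * Complex.I) ∉ V := by
    intro t ht
    have h1 := hR _ ht
    have h2 : ‖(S : ℂ) * Complex.exp (t * Complex.I)‖ = S := by
      rw [norm_mul, Complex.norm_exp_ofReal_mul_I, mul_one, Complex.norm_real, Real.norm_of_nonneg hSpos.le]
    have h3 := norm_sub_le (z + S * Complex.exp (t * Complex.I)) z
    rw [add_sub_cancel_left, h2] at h3
    have := le_abs_self R
    simp only [S] at h3
    linarith
  have hval : ∀ t : ℝ, Complex.exp (H (z + S * Complex.exp (t * Complex.I))) =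
      S * Complex.exp (t * Complex.I) := by
    intro t
    rw [hH]
    simp [F, hout t]
  have := exp_lift_eq (s := (univ : Set ℝ)) isPreconnected_univ
    (g₁ := fun t : ℝ => H (z + S * Complex.exp (t * Complex.I)))
    (g₂ := fun t : ℝ => H (z + S) + t * Complex.I) (by fun_prop) (by fun_prop)
    (by
      intro t _
      have h0 := hval 0
      simp only [Complex.ofReal_zero, zero_mul, Complex.exp_zero, mul_one] at h0
      rw [hval, Complex.exp_add, h0]) (mem_univ 0) (by simp) (2 * Real.pi) (mem_univ _)
  simp only [Complex.ofReal_mul, Complex.ofReal_ofNat, Complex.exp_two_pi_mul_I, mul_one] at this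
  have hpi : (2 * Real.pi * Complex.I : ℂ) = 0 := by
    simpa using this
  exact Complex.two_pi_I_ne_zero hpi

lemma hasLog_arc {φ : ℝ → ℂ} (hφ : Continuous φ) {s t : ℝ} (hst : s ≤ t)
    (hinj : InjOn φ (Icc s t)) {z : ℂ} (hz : z ∉ φ '' Icc s t) : HasLog (φ '' Icc s t) z := by
  obtain ⟨H, hHc, hH⟩ := exists_log (fun τ : ℝ => φ (projIcc s t hst τ) - z)
    (by fun_prop) (fun τ h => hz ⟨_, (projIcc s t hst τ).2, sub_eq_zero.1 h⟩)
  have hemb : IsEmbedding (fun x : Icc s t => φ x) :=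
    (Continuous.isClosedEmbedding (by fun_prop) (fun x y h => Subtype.ext (hinj x.2 y.2 h))).isEmbedding
  let inv := Function.invFunOn φ (Icc s t)
  have hinv : ∀ y ∈ φ '' Icc s t, inv y ∈ Icc s t ∧ φ (inv y) = y := fun y hy =>
    Function.invFunOn_pos hy
  have hic : ContinuousOn inv (φ '' Icc s t) := by
    rw [continuousOn_iff_continuous_domRestrict]
    have : Continuous (fun y : φ '' Icc s t => (⟨inv y, (hinv y y.2).1⟩ : Icc s t)) := by
      rw [hemb.continuous_iff]
      refine continuous_subtype_val.congr fun y => ?_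
      exact (hinv y y.2).2.symm
    exact continuous_subtype_val.comp this
  refine ⟨fun y => H (inv y), hHc.comp_continuousOn hic, fun y hy => ?_⟩
  rw [hH, projIcc_of_mem hst (hinv y hy).1, (hinv y hy).2]

end JD

namespace JD

structure Param (φ : ℝ → ℂ) : Prop where
  cont : Continuous φ
  per : ∀ t, φ (t + 2 * Real.pi) = φ t
  inj : ∀ s t, φ s = φ t → |s - t| < 2 * Real.pi → s = t

namespace Param
variable {φ : ℝ → ℂ}

lemma exists_rep (h : Param φ) (s : ℝ) {y : ℂ} (hy : y ∈ range φ) :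
    ∃ t ∈ Ico s (s + 2 * Real.pi), φ t = y := by
  obtain ⟨t, rfl⟩ := hy
  have hp : Function.Periodic φ (2 * Real.pi) := h.per
  obtain ⟨u, hu, he⟩ := hp.exists_mem_Ico Real.two_pi_pos t s
  exact ⟨u, hu, he.symm⟩

lemma range_eq (h : Param φ) : range φ = φ '' Icc 0 (2 * Real.pi) := by
  apply Subset.antisymm
  · intro y hy
    obtain ⟨t, ht, rfl⟩ := h.exists_rep 0 hy
    exact ⟨t, by simpa using Ico_subset_Icc_self ht, rfl⟩
  · exact image_subset_range _ _

lemma isCompact (h : Param φ) : IsCompact (range φ) := by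
  rw [h.range_eq]
  exact isCompact_Icc.image h.cont

lemma hasLog (h : Param φ) {s t : ℝ} (hst : s ≤ t) (ht : t < s + 2 * Real.pi) {z : ℂ}
    (hz : z ∉ φ '' Icc s t) : HasLog (φ '' Icc s t) z := by
  refine hasLog_arc h.cont hst ?_ hz
  intro x hx y hy he
  refine h.inj x y he ?_
  rw [abs_lt]
  constructor <;> linarith [hx.1, hx.2, hy.1, hy.2]

lemma exists_arc (h : Param φ) {F : Set ℂ} (hF : IsClosed F) {a : ℂ} (ha : a ∈ range φ)
    (haF : a ∉ F) : ∃ J : Set ℂ, IsCompact J ∧ J ⊆ range φ ∧ a ∉ J ∧ range φ ∩ F ⊆ J ∧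
      ∀ z ∉ J, HasLog J z := by
  obtain ⟨τ, rfl⟩ := ha
  have hop : IsOpen (φ ⁻¹' Fᶜ) := hF.isOpen_compl.preimage h.cont
  obtain ⟨r, hr, hb⟩ := Metric.isOpen_iff.1 hop τ haF
  have hpi := Real.pi_pos
  obtain ⟨δ, hδ0, hδr, hδπ⟩ : ∃ δ : ℝ, 0 < δ ∧ δ < r ∧ δ < Real.pi :=
    ⟨min r Real.pi / 2, by positivity, by linarith [min_le_left r Real.pi, lt_min hr hpi],
      by linarith [min_le_right r Real.pi, lt_min hr hpi]⟩
  refine ⟨φ '' Icc (τ + δ) (τ + 2 * Real.pi - δ), isCompact_Icc.image h.cont,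
    image_subset_range _ _, ?_, ?_, fun z hz => h.hasLog (by linarith) (by linarith) hz⟩
  · rintro ⟨t, ht, he⟩
    have := h.inj t τ he (by rw [abs_lt]; constructor <;> linarith [ht.1, ht.2])
    linarith [ht.1]
  · rintro y ⟨hy, hyF⟩
    obtain ⟨t, ht, rfl⟩ := h.exists_rep τ hy
    refine ⟨t, ⟨?_, ?_⟩, rfl⟩
    · by_contra! hlt
      exact hb (by rw [Metric.mem_ball, Real.dist_eq, abs_lt]; constructor <;> linarith [ht.1]) hyF
    · by_contra! hlt
      refine hb (a := t - 2 * Real.pi) (by rw [Metric.mem_ball, Real.dist_eq, abs_lt]; constructor <;> linarith [ht.2]) ?_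
      have := h.per (t - 2 * Real.pi)
      rw [sub_add_cancel] at this
      rwa [← this]

lemma frontier_eq (h : Param φ) {U : Set ℂ} (hne : U.Nonempty) (hb : Bornology.IsBounded U)
    (hUΓ : Disjoint U (range φ)) (hf : frontier U ⊆ range φ) : frontier U = range φ := by
  refine hf.antisymm fun a ha => ?_
  by_contra haf
  obtain ⟨J, hJ, hJΓ, -, hFJ, hlog⟩ := h.exists_arc isClosed_frontier ha haf
  obtain ⟨z, hz⟩ := hne
  exact not_hasLog hJ.isClosed hb (fun x hx => hFJ ⟨hf hx, hx⟩) hz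
    (hlog z fun hzJ => disjoint_left.1 hUΓ hz (hJΓ hzJ))

lemma frontier_hasLog_subset {X : Set ℂ} (hX : IsClosed X) : frontier {z | HasLog X z} ⊆ X := by
  intro x hx
  by_contra hxX
  rw [frontier, (isOpen_hasLog hX).interior_eq] at hx
  obtain ⟨y, hy1, hy2⟩ := mem_closure_iff.1 hx.1 _ (isOpen_not_hasLog hX) ⟨hxX, hx.2⟩
  exact hy1.2 hy2

lemma mem_closure_ext (h : Param φ) {a : ℂ} (ha : a ∈ range φ) :
    a ∈ closure {z | HasLog (range φ) z} := by
  by_contra hac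
  set W := {z | HasLog (range φ) z} with hW
  have hcl := h.isCompact.isClosed
  obtain ⟨J, hJ, hJΓ, haJ, hFJ, hlog⟩ := h.exists_arc (F := closure W) isClosed_closure ha hac
  have hWo : IsOpen W := isOpen_hasLog hcl
  have hfW : frontier W ⊆ J := fun x hx =>
    hFJ ⟨frontier_hasLog_subset hcl hx, frontier_subset_closure hx⟩
  refine not_hasLog (V := (J ∪ W)ᶜ) hJ.isClosed ?_ ?_ (z := a) ?_ (hlog a haJ)
  · obtain ⟨R, hR⟩ := hasLog_far h.isCompact.isBounded
    refine (isBounded_iff_forall_norm_le).2 ⟨R, fun x hx => ?_⟩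
    by_contra! hlt
    exact hx (Or.inr (hR x hlt))
  · rw [frontier_compl]
    refine (frontier_union_subset _ _).trans ?_
    rintro x (hx | hx)
    · exact hJ.isClosed.frontier_subset hx.1
    · exact hfW hx.2
  · rintro (h1 | h1)
    · exact haJ h1
    · exact hac (subset_closure h1)

lemma ext_hasLog (h : Param φ) {U : Set ℂ} (hb : Bornology.IsBounded U)
    (hf : frontier U = range φ) {p : ℂ} (hp : HasLog (range φ) p) : HasLog (closure U) p := by
  by_contra hn
  have hcl := h.isCompact.isClosed
  have hΓU : range φ ⊆ closure U := hf ▸ frontier_subset_closure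
  have hdis : ∀ x, HasLog (range φ) x → x ∉ closure U := by
    intro x hx hxU
    by_cases hxU' : x ∈ U
    · exact not_hasLog hcl hb hf.subset hxU' hx
    · exact hx.not_mem (hf ▸ ⟨hxU, fun hi => hxU' (interior_subset hi)⟩)
  refine not_hasLog (V := {z | HasLog (range φ) z} ∩ {z | z ∉ closure U ∧ ¬ HasLog (closure U) z})
    hcl ?_ ?_ (z := p) ⟨hp, hdis p hp, hn⟩ hp
  · obtain ⟨R, hR⟩ := hasLog_far hb.closure
    refine (isBounded_iff_forall_norm_le).2 ⟨R, fun x hx => ?_⟩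
    by_contra! hlt
    exact hx.2.2 (hR x hlt)
  · intro x hx
    by_contra hxΓ
    rw [frontier, ((isOpen_hasLog hcl).inter (isOpen_not_hasLog isClosed_closure)).interior_eq] at hx
    have h1 : HasLog (range φ) x := by
      by_contra h1
      obtain ⟨y, hy1, hy2⟩ := mem_closure_iff.1 hx.1 _ (isOpen_not_hasLog hcl) ⟨hxΓ, h1⟩
      exact hy1.2 hy2.1
    have h2 : HasLog (closure U) x := by
      by_contra h2
      exact hx.2 ⟨h1, hdis x h1, h2⟩
    obtain ⟨y, hy1, hy2⟩ := mem_closure_iff.1 hx.1 _ (isOpen_hasLog isClosed_closure) h2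
    exact hy2.2.2 hy1

/-- Points of the curve off a closed subset of `closure U` are not separated from infinity. -/
lemma hasLog_of_mem (h : Param φ) {U : Set ℂ} (hb : Bornology.IsBounded U)
    (hf : frontier U = range φ) {X : Set ℂ} (hX : IsClosed X) (hXU : X ⊆ closure U) {a : ℂ}
    (ha : a ∈ range φ) (haX : a ∉ X) : HasLog X a := by
  obtain ⟨r, hr, hloc⟩ := hasLog_loc hX haX
  obtain ⟨p, hp, hpr⟩ := Metric.mem_closure_iff.1 (h.mem_closure_ext ha) r hr
  exact hloc p (by rwa [Metric.mem_ball, dist_comm]) a (Metric.mem_ball_self hr)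
    ((h.ext_hasLog hb hf hp).mono hXU)

lemma separation (h : Param φ) {U K A B : Set ℂ} (hb : Bornology.IsBounded U)
    (hf : frontier U = range φ) (hK : IsClosed K) (hKU : K ⊆ closure U)
    (hKc : IsConnected K) (hA : IsClosed A) (hB : IsClosed B) (hAB : A ∪ B = range φ)
    (hABK : A ∩ B ⊆ K) {a b : ℂ} (ha : a ∈ A) (hbB : b ∈ B) (haK : a ∉ K) (hbK : b ∉ K)
    {C : Set ℂ} (hC : IsPreconnected C) (hCs : C ⊆ closure U \ K) (haC : a ∈ C) (hbC : b ∈ C) :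
    False := by
  have hcl := h.isCompact.isClosed
  have hΓU : range φ ⊆ closure U := hf ▸ frontier_subset_closure
  have hAΓ : A ⊆ range φ := hAB ▸ subset_union_left
  have hBΓ : B ⊆ range φ := hAB ▸ subset_union_right
  have hKA : IsClosed (K ∪ A) := hK.union hA
  have hKB : IsClosed (K ∪ B) := hK.union hB
  have hU : ∀ z ∈ U, HasLog (K ∪ A) z → HasLog (K ∪ B) z → False := by
    intro z hz h1 h2
    have hi : (K ∪ A) ∩ (K ∪ B) = K := by
      rw [← union_inter_distrib_left, union_eq_left.2 hABK]
    have h3 := HasLog.union hKA hKB (by rw [hi]; exact hKc) h1 h2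
    refine not_hasLog hcl hb hf.subset hz (h3.mono ?_)
    rw [← hAB]
    exact union_subset_union subset_union_right subset_union_right
  have hAl : ∀ z ∈ A, z ∉ K → HasLog (K ∪ B) z := fun z hz hzK =>
    h.hasLog_of_mem hb hf hKB (union_subset hKU (hBΓ.trans hΓU)) (hAΓ hz)
      (by rintro (h1 | h1); exacts [hzK h1, hzK (hABK ⟨hz, h1⟩)])
  have hBl : ∀ z ∈ B, z ∉ K → HasLog (K ∪ A) z := fun z hz hzK =>
    h.hasLog_of_mem hb hf hKA (union_subset hKU (hAΓ.trans hΓU)) (hBΓ hz)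
      (by rintro (h1 | h1); exacts [hzK h1, hzK (hABK ⟨h1, hz⟩)])
  obtain ⟨z, hzC, hz1, hz2⟩ := hC {z | HasLog (K ∪ A) z}
    ({z | HasLog (K ∪ B) z} ∪ {z | z ∉ K ∪ A ∧ ¬ HasLog (K ∪ A) z})
    (isOpen_hasLog hKA) ((isOpen_hasLog hKB).union (isOpen_not_hasLog hKA))
    (by
      intro z hz
      by_cases hzA : z ∈ A
      · exact Or.inr (Or.inl (hAl z hzA (hCs hz).2))
      · by_cases hl : HasLog (K ∪ A) z
        · exact Or.inl hl
        · exact Or.inr (Or.inr ⟨by rintro (h1 | h1); exacts [(hCs hz).2 h1, hzA h1], hl⟩))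
    ⟨b, hbC, hBl b hbB hbK⟩ ⟨a, haC, Or.inl (hAl a ha haK)⟩
  rcases hz2 with hz2 | hz2
  · by_cases hzU : z ∈ U
    · exact hU z hzU hz1 hz2
    · have : z ∈ A ∪ B := by
        rw [hAB, ← hf]
        exact ⟨(hCs hzC).1, fun hi => hzU (interior_subset hi)⟩
      rcases this with h1 | h1
      · exact HasLog.not_mem hz1 (Or.inr h1)
      · exact HasLog.not_mem hz2 (Or.inr h1)
  · exact hz2.2 hz1

lemma core (h : Param φ) {U K : Set ℂ} (hne : U.Nonempty) (hb : Bornology.IsBounded U)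
    (hUΓ : Disjoint U (range φ)) (hf' : frontier U ⊆ range φ) (hK : IsClosed K)
    (hKU : K ⊆ closure U) (hKc : IsConnected K) {a b : ℂ}
    (ha : a ∈ frontier U \ K) (hbb : b ∈ frontier U \ K)
    (hsep : connectedComponentIn (frontier U \ K) a ≠
      connectedComponentIn (frontier U \ K) b) :
    connectedComponentIn (closure U \ K) a ≠
      connectedComponentIn (closure U \ K) b := by
  intro heq
  have hf := h.frontier_eq hne hb hUΓ hf'
  have hpi := Real.pi_pos
  have hper' : ∀ t, φ (t - 2 * Real.pi) = φ t := fun t => by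
    have := h.per (t - 2 * Real.pi)
    rw [sub_add_cancel] at this
    exact this.symm
  obtain ⟨α, hα⟩ : a ∈ range φ := hf' ha.1
  obtain ⟨β, hβ, hβb⟩ := h.exists_rep α (hf' hbb.1)
  have hαβ : α < β := by
    refine lt_of_le_of_ne hβ.1 fun hh => hsep ?_
    rw [← hα, ← hβb, hh]
  -- points of `K` on both arcs
  have cross : ∀ s t, s ≤ t → (∀ u ∈ Icc s t, φ u ∉ K) →
      connectedComponentIn (frontier U \ K) (φ s) = connectedComponentIn (frontier U \ K) (φ t) := by
    intro s t hst hu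
    have hsub : φ '' Icc s t ⊆ frontier U \ K := by
      rintro _ ⟨u, hu', rfl⟩
      exact ⟨hf ▸ mem_range_self u, hu u hu'⟩
    have := (isPreconnected_Icc.image φ h.cont.continuousOn).subset_connectedComponentIn
      (mem_image_of_mem φ (left_mem_Icc.2 hst)) hsub
    exact connectedComponentIn_eq (this (mem_image_of_mem φ (right_mem_Icc.2 hst)))
  obtain ⟨γ, hγ, hγK⟩ : ∃ u ∈ Icc α β, φ u ∈ K := by
    by_contra! hcon
    have := cross α β hαβ.le hcon
    rw [hα, hβb] at this
    exact hsep this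
  obtain ⟨δ, hδ, hδK⟩ : ∃ u ∈ Icc β (α + 2 * Real.pi), φ u ∈ K := by
    by_contra! hcon
    have := cross β (α + 2 * Real.pi) hβ.2.le hcon
    rw [h.per, hα, hβb] at this
    exact hsep this.symm
  have hγα : γ ≠ α := fun hh => ha.2 (by rwa [← hα, ← hh])
  have hγβ : γ ≠ β := fun hh => hbb.2 (by rwa [← hβb, ← hh])
  have hδβ : δ ≠ β := fun hh => hbb.2 (by rwa [← hβb, ← hh])
  have h1 := lt_of_le_of_ne hγ.1 hγα.symm
  have h2 := lt_of_le_of_ne hγ.2 hγβ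
  have h3 := lt_of_le_of_ne hδ.1 hδβ.symm
  have h4 := hδ.2
  have haC : a ∈ closure U \ K := ⟨frontier_subset_closure ha.1, ha.2⟩
  have hbC : b ∈ closure U \ K := ⟨frontier_subset_closure hbb.1, hbb.2⟩
  refine h.separation (A := φ '' Icc (δ - 2 * Real.pi) γ) (B := φ '' Icc γ δ) hb hf hK hKU hKc
    (isCompact_Icc.image h.cont).isClosed (isCompact_Icc.image h.cont).isClosed ?_ ?_
    ⟨α, ⟨by linarith, by linarith⟩, hα⟩ ⟨β, ⟨by linarith, by linarith⟩, hβb⟩ ha.2 hbb.2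
    (isPreconnected_connectedComponentIn (F := closure U \ K) (x := a))
    (connectedComponentIn_subset _ _) (mem_connectedComponentIn haC)
    (heq ▸ mem_connectedComponentIn hbC)
  · apply Subset.antisymm
    · exact union_subset (image_subset_range _ _) (image_subset_range _ _)
    · intro y hy
      obtain ⟨t, ht, rfl⟩ := h.exists_rep (δ - 2 * Real.pi) hy
      rcases le_total t γ with htγ | htγ
      · exact Or.inl ⟨t, ⟨ht.1, htγ⟩, rfl⟩
      · exact Or.inr ⟨t, ⟨htγ, by linarith [ht.2]⟩, rfl⟩
  · rintro _ ⟨⟨s, hs, rfl⟩, ⟨t, ht, hts⟩⟩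
    by_cases hst : |t - s| < 2 * Real.pi
    · have := h.inj t s hts hst
      have : s = γ := le_antisymm hs.2 (this ▸ ht.1)
      rwa [this]
    · have : t = δ := by
        refine le_antisymm ht.2 ?_
        by_contra! hlt
        exact hst (by rw [abs_lt]; constructor <;> linarith [hs.1, hs.2, ht.1])
      rwa [← hts, this]

end Param

end JD

namespace JD

lemma exists_param {Γ : Set (EuclideanSpace ℝ (Fin 2))} (hΓ : IsJordanCurve Γ)
    (e : EuclideanSpace ℝ (Fin 2) ≃ₜ ℂ) : ∃ φ : ℝ → ℂ, Param φ ∧ range φ = e '' Γ := by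
  obtain ⟨h⟩ := hΓ
  have hmem : ∀ t : ℝ, (!₂[Real.cos t, Real.sin t] : EuclideanSpace ℝ (Fin 2)) ∈
      Metric.sphere (0 : EuclideanSpace ℝ (Fin 2)) 1 := by
    intro t
    simp [EuclideanSpace.norm_eq]
  let ψ : ℝ → Metric.sphere (0 : EuclideanSpace ℝ (Fin 2)) 1 := fun t => ⟨_, hmem t⟩
  have hψc : Continuous ψ := by
    refine Continuous.subtype_mk ?_ _
    refine (PiLp.continuous_toLp 2 _).comp (continuous_pi fun i => ?_)
    fin_cases i
    · exact Real.continuous_cos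
    · exact Real.continuous_sin
  refine ⟨fun t => e (h.symm (ψ t)), ⟨by fun_prop, ?_, ?_⟩, ?_⟩
  · intro t
    have : ψ (t + 2 * Real.pi) = ψ t := Subtype.ext (by simp [ψ])
    simp only [this]
  · intro s t hst habs
    have h1 : ψ s = ψ t := h.symm.injective (Subtype.ext (e.injective hst))
    have h2 := congrArg Subtype.val h1
    have hc : Real.cos s = Real.cos t := congrFun (congrArg WithLp.ofLp h2) 0
    have hs : Real.sin s = Real.sin t := congrFun (congrArg WithLp.ofLp h2) 1
    obtain ⟨n, hn⟩ := Real.Angle.angle_eq_iff_two_pi_dvd_sub.1 (Real.Angle.cos_sin_inj hc hs)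
    rw [hn, abs_mul, abs_of_pos Real.two_pi_pos] at habs
    have h3 : |(n : ℝ)| < 1 := by
      by_contra! hcon
      nlinarith [Real.two_pi_pos]
    have h4 : n = 0 := by
      have : |n| < 1 := by exact_mod_cast h3
      exact Int.abs_lt_one_iff.1 this
    rw [h4] at hn
    simp at hn
    linarith
  · apply Subset.antisymm
    · rintro _ ⟨t, rfl⟩
      exact ⟨_, (h.symm (ψ t)).2, rfl⟩
    · rintro _ ⟨x, hx, rfl⟩
      have hsurj : ∃ t, ψ t = h ⟨x, hx⟩ := by
        obtain ⟨y, hy⟩ := h ⟨x, hx⟩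
        have hy' : y 0 ^ 2 + y 1 ^ 2 = 1 := by
          simpa [EuclideanSpace.norm_eq, Fin.sum_univ_two] using hy
        let w : ℂ := ⟨y 0, y 1⟩
        have hw : ‖w‖ = 1 := by
          rw [← sq_eq_sq₀ (norm_nonneg _) zero_le_one, Complex.sq_norm, Complex.normSq_apply]
          simp only [w]
          linarith
        have hw0 : w ≠ 0 := by
          intro h0
          simp [h0] at hw
        refine ⟨w.arg, Subtype.ext ?_⟩
        ext i
        fin_cases i
        · simp [ψ, Complex.cos_arg hw0, hw, w]
        · simp [ψ, Complex.sin_arg, hw, w]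
      obtain ⟨t, ht⟩ := hsurj
      exact ⟨t, by simp [ht]⟩

lemma frontier_component {Γ : Set (EuclideanSpace ℝ (Fin 2))} (hΓ : IsClosed Γ)
    (z : EuclideanSpace ℝ (Fin 2)) :
    frontier (connectedComponentIn Γᶜ z) ⊆ Γ := by
  intro x hx
  by_contra hxΓ
  have ho : IsOpen (connectedComponentIn Γᶜ z) := hΓ.isOpen_compl.connectedComponentIn
  have ho' : IsOpen (connectedComponentIn Γᶜ x) := hΓ.isOpen_compl.connectedComponentIn
  rw [frontier, ho.interior_eq] at hx
  obtain ⟨y, hy1, hy2⟩ := mem_closure_iff.1 hx.1 _ ho' (mem_connectedComponentIn hxΓ)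
  apply hx.2
  rw [connectedComponentIn_eq hy2, ← connectedComponentIn_eq hy1]
  exact mem_connectedComponentIn hxΓ

end JD

theorem stmt9 (U K : Set (EuclideanSpace ℝ (Fin 2))) (hU : IsJordanDomain U)
    (hKU : K ⊆ closure U) (hKc : IsCompact K) (hKconn : IsConnected K)
    (a b : EuclideanSpace ℝ (Fin 2))
    (ha : a ∈ frontier U \ K) (hb : b ∈ frontier U \ K)
    (hsep : connectedComponentIn (frontier U \ K) a ≠
      connectedComponentIn (frontier U \ K) b) :
    connectedComponentIn (closure U \ K) a ≠
      connectedComponentIn (closure U \ K) b := by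
  obtain ⟨Γ, z, hΓ, hz, hUz, hUb⟩ := hU
  let L := Complex.orthonormalBasisOneI.repr.symm
  let e : EuclideanSpace ℝ (Fin 2) ≃ₜ ℂ := L.toHomeomorph
  obtain ⟨φ, hφ, hrange⟩ := JD.exists_param hΓ e
  have hΓc : IsClosed Γ := by
    have := hφ.isCompact.isClosed
    rw [hrange] at this
    exact e.isClosed_image.1 this
  have hcl : e '' (closure U \ K) = closure (e '' U) \ e '' K := by
    rw [image_sdiff e.injective, e.image_closure]
  have hfr : e '' (frontier U \ K) = frontier (e '' U) \ e '' K := by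
    rw [image_sdiff e.injective, e.image_frontier]
  have ha' : a ∈ closure U \ K := ⟨frontier_subset_closure ha.1, ha.2⟩
  have hb' : b ∈ closure U \ K := ⟨frontier_subset_closure hb.1, hb.2⟩
  have hfU : frontier U ⊆ Γ := hUz ▸ JD.frontier_component hΓc z
  have hdisj : Disjoint U Γ := by
    rw [hUz, disjoint_left]
    exact fun x hx => connectedComponentIn_subset _ _ hx
  have hne : U.Nonempty := ⟨z, hUz ▸ mem_connectedComponentIn hz⟩
  intro heq
  refine hφ.core (U := e '' U) (K := e '' K) (a := e a) (b := e b) (hne.image e) ?_ ?_ ?_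
    (hKc.image e.continuous).isClosed ?_ (hKconn.image e e.continuous.continuousOn) ?_ ?_ ?_ ?_
  · exact L.lipschitz.isBounded_image hUb
  · rw [hrange]
    exact (disjoint_image_iff e.injective).2 hdisj
  · rw [hrange, ← e.image_frontier]
    exact image_mono hfU
  · rw [← e.image_closure]
    exact image_mono hKU
  · rw [← hfr]
    exact mem_image_of_mem e ha
  · rw [← hfr]
    exact mem_image_of_mem e hb
  · rw [← hfr, ← e.image_connectedComponentIn ha, ← e.image_connectedComponentIn hb]
    exact fun hh => hsep (e.injective.image_injective hh)
  · rw [← hcl, ← e.image_connectedComponentIn ha', ← e.image_connectedComponentIn hb', heq]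
end
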